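/- arXiv:1805.03997 — 2 statements merged into one kernel-verified Lean document; each statement's English description precedes it below -/
import Mathlib

section
/- If f is a normalized analytic function on the unit disc belonging to M(δ) for π/2 ≤ δ < π (i.e., 1 + (δ-π)/(2 sin δ) < Re(zf'(z)/f(z)) < 1 + δ/(2 sin δ)), then log(f(z)/z) is subordinate to B̃_δ(z) = ∫₀^z B_δ(t)/t dt, where B_δ(z) = (1/(2i sin δ)) log((1+ze^{iδ})/(1+ze^{-iδ})). -/
open Complex Metric

/-- Dorff's function `B_δ`. -/
noncomputable def Bdelta (δ : ℝ) (z : ℂ) : ℂ :=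
  (1 / (2 * Complex.I * Real.sin δ)) *
    Complex.log ((1 + z * Complex.exp (Complex.I * δ)) /
      (1 + z * Complex.exp (-Complex.I * δ)))

/-- `B̃_δ(z) = ∫₀^z B_δ(t)/t dt`, parametrized along the segment. -/
noncomputable def Btilde (δ : ℝ) (z : ℂ) : ℂ :=
  ∫ t in (0 : ℝ)..1, Bdelta δ ((t : ℂ) * z) / ((t : ℂ) * z) * z

/-- Subordination on the unit disc. -/
def Subord (g h : ℂ → ℂ) : Prop :=
  ∃ ω : ℂ → ℂ, DifferentiableOn ℂ ω (ball 0 1) ∧ ω 0 = 0 ∧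
    (∀ z ∈ ball (0 : ℂ) 1, ω z ∈ ball (0 : ℂ) 1) ∧
    ∀ z ∈ ball (0 : ℂ) 1, g z = h (ω z)

section

open Set Filter Topology ComplexConjugate

/-- If `‖γ‖` does not exceed `‖γ 0‖` on `(0, 1)`, its initial derivative is nonpositive. -/
lemma re_conj_mul_nonpos_of_norm_le {γ : ℝ → ℂ} {d : ℂ} (hγ : HasDerivAt γ d 0)
    (hle : ∀ s ∈ Ioo (0 : ℝ) 1, ‖γ s‖ ≤ ‖γ 0‖) : (conj (γ 0) * d).re ≤ 0 := by
  have hsq : HasDerivAt (fun s => ‖γ s‖ ^ 2) (2 * inner ℝ (γ 0) d) 0 := hγ.norm_sq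
  have hslope : Tendsto (slope (fun s => ‖γ s‖ ^ 2) 0) (𝓝[>] 0) (𝓝 (2 * inner ℝ (γ 0) d)) :=
    (hasDerivWithinAt_iff_tendsto_slope' (by simp)).1 (hsq.hasDerivWithinAt (s := Ioi 0))
  have hlim : 2 * inner ℝ (γ 0) d ≤ 0 := by
    refine le_of_tendsto hslope ?_
    filter_upwards [Ioo_mem_nhdsGT (zero_lt_one' ℝ)] with s hs
    rw [slope_def_field, sub_zero]
    exact div_nonpos_of_nonpos_of_nonneg
      (sub_nonpos.2 (pow_le_pow_left₀ (norm_nonneg _) (hle s hs) 2)) hs.1.le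
  rw [Complex.inner, mul_comm d] at hlim
  linarith

/-- At a maximum of `‖v‖` over the disc `‖z‖ ≤ ‖z₀‖` attained at `z₀`, the logarithmic derivative
`z₀ v'(z₀) / v(z₀)` is a nonnegative real. -/
lemma exists_nonneg_mul_deriv_eq_of_norm_le {v : ℂ → ℂ} {z₀ : ℂ} (hv : DifferentiableAt ℂ v z₀)
    (h0 : v z₀ ≠ 0) (hmax : ∀ z, ‖z‖ ≤ ‖z₀‖ → ‖v z‖ ≤ ‖v z₀‖) :
    ∃ s : ℝ, 0 ≤ s ∧ z₀ * deriv v z₀ = s * v z₀ := by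
  have key : ∀ (γ : ℝ → ℂ) (d : ℂ), γ 0 = z₀ → HasDerivAt γ d 0 →
      (∀ s ∈ Ioo (0 : ℝ) 1, ‖γ s‖ ≤ ‖z₀‖) → (conj (v z₀) * (deriv v z₀ * d)).re ≤ 0 := by
    intro γ d hγ0 hγ hle
    have hcomp : HasDerivAt (v ∘ γ) (deriv v z₀ * d) 0 :=
      HasDerivAt.comp_of_eq 0 hv.hasDerivAt hγ hγ0.symm
    have := re_conj_mul_nonpos_of_norm_le hcomp fun s hs => by
      simpa [hγ0] using hmax _ (hle s hs)
    simpa [hγ0] using this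
  have hrot : ∀ ε : ℝ, HasDerivAt (fun s : ℝ => Complex.exp ((ε * s : ℝ) * I) * z₀)
      (ε * I * z₀) 0 := by
    intro ε
    have h1 : HasDerivAt (fun s : ℝ => ((ε * s : ℝ) : ℂ) * I) (ε * I) 0 := by
      simpa using (((hasDerivAt_id (0 : ℝ)).const_mul ε).ofReal_comp).mul_const I
    simpa using h1.cexp.mul_const z₀
  have hrotle : ∀ ε : ℝ, (conj (v z₀) * (deriv v z₀ * (ε * I * z₀))).re ≤ 0 := fun ε =>
    key _ _ (by simp) (hrot ε) fun s _ => by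
      rw [norm_mul, Complex.norm_exp_ofReal_mul_I, one_mul]
  have hrad : (conj (v z₀) * (deriv v z₀ * (-z₀))).re ≤ 0 := by
    refine key (fun s : ℝ => (1 - (s : ℂ)) * z₀) _ (by simp) ?_ ?_
    · simpa using (((hasDerivAt_id (0 : ℝ)).ofReal_comp).const_sub 1).mul_const z₀
    · intro s hs
      have : ‖(1 - (s : ℂ))‖ ≤ 1 := by
        rw [← ofReal_one, ← ofReal_sub, norm_real, Real.norm_eq_abs, abs_le]
        constructor <;> linarith [hs.1, hs.2]
      rw [norm_mul]
      exact mul_le_of_le_one_left (norm_nonneg _) this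
  have hp := hrotle 1
  have hm := hrotle (-1)
  set c := conj (v z₀) * (z₀ * deriv v z₀) with hc
  have e1 : conj (v z₀) * (deriv v z₀ * (((1 : ℝ) : ℂ) * I * z₀)) = c * I := by
    rw [hc]; push_cast; ring
  have e2 : conj (v z₀) * (deriv v z₀ * (((-1 : ℝ) : ℂ) * I * z₀)) = -(c * I) := by
    rw [hc]; push_cast; ring
  have e3 : conj (v z₀) * (deriv v z₀ * (-z₀)) = -c := by
    rw [hc]; ring
  rw [e1, Complex.mul_I_re] at hp
  rw [e2, Complex.neg_re, Complex.mul_I_re] at hm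
  rw [e3, Complex.neg_re] at hrad
  have hcre : c = (c.re : ℂ) := Complex.ext (by simp) (by simp; linarith)
  refine ⟨c.re / normSq (v z₀), div_nonneg (by linarith) (normSq_nonneg _), ?_⟩
  have hconj : conj (v z₀) ≠ 0 := by simpa using h0
  push_cast
  rw [← hcre, Complex.normSq_eq_conj_mul_self, hc]
  field_simp

/-- **Noshiro–Warschawski**: a function whose derivative has positive real part on a convex set
is injective there. -/
lemma injOn_of_re_deriv_pos {S : Set ℂ} (hS : Convex ℝ S) {F F' : ℂ → ℂ}
    (hF : ∀ w ∈ S, HasDerivAt F (F' w) w) (hpos : ∀ w ∈ S, 0 < (F' w).re) : InjOn F S := by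
  intro a ha b hb hab
  by_contra hne
  have hd : b - a ≠ 0 := sub_ne_zero.2 (Ne.symm hne)
  have hmem : ∀ t ∈ Icc (0 : ℝ) 1, a + t * (b - a) ∈ S := fun t ht => by
    simpa using hS.add_smul_sub_mem ha hb ht
  have hder : ∀ t ∈ Icc (0 : ℝ) 1,
      HasDerivAt (fun t : ℝ => (F (a + t * (b - a)) / (b - a)).re)
        (F' (a + t * (b - a))).re t := by
    intro t ht
    have h1 : HasDerivAt (fun t : ℝ => a + t * (b - a)) (b - a) t := by
      simpa using (((hasDerivAt_id t).ofReal_comp).mul_const (b - a)).const_add a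
    have h2 := ((hF _ (hmem t ht)).comp t h1).div_const (b - a)
    rw [mul_div_cancel_right₀ _ hd] at h2
    exact (Complex.reCLM.hasFDerivAt.comp_hasDerivAt t h2)
  have hmono := strictMonoOn_of_deriv_pos (convex_Icc (0 : ℝ) 1)
    (HasDerivAt.continuousOn hder) fun t ht => by
      have ht' := interior_subset ht
      rw [(hder t ht').deriv]
      exact hpos _ (hmem t ht')
  have := hmono (left_mem_Icc.2 zero_le_one) (right_mem_Icc.2 zero_le_one) zero_lt_one
  simp [hab] at this

/-- A holomorphic function with nonnegative real part which is `1` somewhere has positive real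
part everywhere on a connected open set. -/
lemma re_pos_of_re_nonneg {S : Set ℂ} (hSc : IsPreconnected S) (hSo : IsOpen S) {q : ℂ → ℂ}
    (hq : DifferentiableOn ℂ q S) (hnn : ∀ w ∈ S, 0 ≤ (q w).re) {a : ℂ} (ha : a ∈ S)
    (hqa : q a = 1) : ∀ w ∈ S, 0 < (q w).re := by
  intro w hw
  refine (hnn w hw).lt_of_ne fun h => ?_
  have := norm_eqOn_of_isPreconnected_of_isMaxOn hSc hSo (f := fun w => Complex.exp (-q w))
    hq.neg.cexp hw (fun x hx => by simp [Complex.norm_exp, ← h, hnn x hx]) ha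
  simp [Complex.norm_exp, ← h, hqa] at this

/-- A complex derivative on an open set is a strict derivative. -/
lemma hasStrictDerivAt_of_forall_hasDerivAt {U : Set ℂ} (hU : IsOpen U) {P k : ℂ → ℂ}
    (hP : ∀ z ∈ U, HasDerivAt P (k z) z) {z : ℂ} (hz : z ∈ U) : HasStrictDerivAt P (k z) z := by
  have hd : DifferentiableOn ℂ P U :=
    fun x hx => (hP x hx).differentiableAt.differentiableWithinAt
  have := (hd.analyticAt (hU.mem_nhds hz)).hasStrictDerivAt
  rwa [(hP z hz).deriv] at this

/-- A biholomorphism `h` from the unit disc onto a convex domain `S`, with inverse `T`,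
normalized by `h 0 = 0`. -/
structure IsConvexMap (h T : ℂ → ℂ) (S : Set ℂ) : Prop where
  isOpen : IsOpen S
  convex : Convex ℝ S
  map_zero : h 0 = 0
  diff : DifferentiableOn ℂ h (ball 0 1)
  mapsTo : MapsTo h (ball 0 1) S
  diff_inv : DifferentiableOn ℂ T S
  mapsTo_inv : MapsTo T S (ball 0 1)
  left_inv : ∀ z ∈ ball (0 : ℂ) 1, T (h z) = z
  right_inv : ∀ w ∈ S, h (T w) = w

namespace IsConvexMap

variable {h T : ℂ → ℂ} {S : Set ℂ}

lemma zero_mem (H : IsConvexMap h T S) : (0 : ℂ) ∈ S := by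
  simpa [H.map_zero] using H.mapsTo (mem_ball_self one_pos)

lemma inv_zero (H : IsConvexMap h T S) : T 0 = 0 := by
  simpa [H.map_zero] using H.left_inv 0 (mem_ball_self one_pos)

lemma smul_mem (H : IsConvexMap h T S) {w : ℂ} (hw : w ∈ S) {t : ℝ} (ht : t ∈ Icc (0 : ℝ) 1) :
    (t : ℂ) * w ∈ S := by
  simpa using H.convex.smul_mem_of_zero_mem H.zero_mem hw ht

/-- Convex maps are starlike: the images of concentric discs are star-shaped about `0`. -/
lemma norm_inv_smul_le (H : IsConvexMap h T S) {w : ℂ} (hw : w ∈ S) {t : ℝ}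
    (ht : t ∈ Icc (0 : ℝ) 1) :
    ‖T (t * w)‖ ≤ ‖T w‖ := by
  have hmaps : MapsTo (fun z => (t : ℂ) * h z) (ball 0 1) S :=
    fun z hz => H.smul_mem (H.mapsTo hz) ht
  have hle := norm_le_norm_of_mapsTo_ball (f := fun z => T (t * h z)) (R := 1) (z := T w)
    (H.diff_inv.comp (H.diff.const_mul _) hmaps)
    (fun z hz => ball_subset_closedBall (H.mapsTo_inv (hmaps hz)))
    (by simp [H.map_zero, H.inv_zero]) (by simpa using H.mapsTo_inv hw)
  simpa [H.right_inv w hw] using hle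

lemma hasDerivAt_inv (H : IsConvexMap h T S) {w : ℂ} (hw : w ∈ S) : HasDerivAt T (deriv T w) w :=
  (H.diff_inv.differentiableAt (H.isOpen.mem_nhds hw)).hasDerivAt

lemma differentiableOn_dslope (H : IsConvexMap h T S) :
    DifferentiableOn ℂ (dslope h 0) (ball 0 1) :=
  (Complex.differentiableOn_dslope (ball_mem_nhds 0 one_pos)).2 H.diff

lemma mul_dslope (H : IsConvexMap h T S) (z : ℂ) : z * dslope h 0 z = h z := by
  simpa [H.map_zero] using sub_smul_dslope h 0 z

lemma deriv_mul_deriv_inv (H : IsConvexMap h T S) : deriv h 0 * deriv T 0 = 1 := by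
  have h1 : HasDerivAt h (deriv h 0) 0 :=
    (H.diff.differentiableAt (ball_mem_nhds 0 one_pos)).hasDerivAt
  have h2 : HasDerivAt (T ∘ h) (deriv T 0 * deriv h 0) 0 :=
    HasDerivAt.comp_of_eq 0 (H.hasDerivAt_inv H.zero_mem) h1 H.map_zero.symm
  have h3 : T ∘ h =ᶠ[𝓝 0] id := by
    filter_upwards [ball_mem_nhds (0 : ℂ) one_pos] with z hz using H.left_inv z hz
  rw [mul_comm]
  exact h2.unique ((hasDerivAt_id (0 : ℂ)).congr_of_eventuallyEq h3)

lemma re_dslope_mul_deriv_pos (H : IsConvexMap h T S) :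
    ∀ w ∈ S, 0 < (dslope h 0 (T w) * deriv T w).re := by
  have hone : dslope h 0 (T 0) * deriv T 0 = 1 := by
    rw [H.inv_zero, dslope_same, H.deriv_mul_deriv_inv]
  refine re_pos_of_re_nonneg H.convex.isPreconnected H.isOpen
    ((H.differentiableOn_dslope.comp H.diff_inv H.mapsTo_inv).mul
      (H.diff_inv.deriv H.isOpen)) (fun w hw => ?_) H.zero_mem hone
  by_cases hTw : T w = 0
  · have hw0 : w = 0 := by rw [← H.right_inv w hw, hTw, H.map_zero]
    simp [hw0, hone]
  have hpath : HasDerivAt (fun s : ℝ => ((1 - s : ℝ) : ℂ) * w) (-w) 0 := by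
    simpa using (((hasDerivAt_id (0 : ℝ)).ofReal_comp).const_sub 1).mul_const w
  have hcomp : HasDerivAt (fun s : ℝ => T (((1 - s : ℝ) : ℂ) * w)) (deriv T w * -w) 0 :=
    HasDerivAt.comp_of_eq 0 (H.hasDerivAt_inv hw) hpath (by simp)
  have hle := re_conj_mul_nonpos_of_norm_le hcomp fun s hs => by
    simpa using H.norm_inv_smul_le hw (t := 1 - s) ⟨by linarith [hs.2], by linarith [hs.1]⟩
  have hEq : dslope h 0 (T w) * deriv T w =
      ((normSq (T w))⁻¹ : ℝ) * -(conj (T w) * (deriv T w * -w)) := by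
    have hprod := H.mul_dslope (T w)
    rw [H.right_inv w hw] at hprod
    have hconj : conj (T w) ≠ 0 := by simpa using hTw
    push_cast
    rw [Complex.normSq_eq_conj_mul_self]
    field_simp
    linear_combination (deriv T w) * hprod
  simp only [sub_zero, ofReal_one, one_mul] at hle
  rw [hEq, re_ofReal_mul, neg_re]
  exact mul_nonneg (inv_nonneg.2 (normSq_nonneg _)) (neg_nonneg.2 hle)

lemma dslope_ne_zero (H : IsConvexMap h T S) {z : ℂ} (hz : z ∈ ball (0 : ℂ) 1) :
    dslope h 0 z ≠ 0 := by
  intro h0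
  have := H.re_dslope_mul_deriv_pos _ (H.mapsTo hz)
  simp [H.left_inv z hz, h0] at this

lemma injOn_primitive (H : IsConvexMap h T S) {P : ℂ → ℂ}
    (hP : ∀ z ∈ ball (0 : ℂ) 1, HasDerivAt P (dslope h 0 z) z) : InjOn P (ball 0 1) := by
  have hinj : InjOn (P ∘ T) S := injOn_of_re_deriv_pos H.convex
    (fun w hw => (hP _ (H.mapsTo_inv hw)).comp w (H.hasDerivAt_inv hw)) H.re_dslope_mul_deriv_pos
  intro a ha b hb hab
  have := hinj (H.mapsTo ha) (H.mapsTo hb) (by simp [H.left_inv a ha, H.left_inv b hb, hab])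
  rw [← H.left_inv a ha, ← H.left_inv b hb, this]

lemma isOpen_image_primitive (H : IsConvexMap h T S) {P : ℂ → ℂ}
    (hP : ∀ z ∈ ball (0 : ℂ) 1, HasDerivAt P (dslope h 0 z) z) : IsOpen (P '' ball 0 1) := by
  rw [isOpen_iff_mem_nhds]
  rintro _ ⟨z, hz, rfl⟩
  rw [← (hasStrictDerivAt_of_forall_hasDerivAt isOpen_ball hP hz).map_nhds_eq (H.dslope_ne_zero hz)]
  exact image_mem_map (isOpen_ball.mem_nhds hz)

lemma differentiableAt_invFunOn (H : IsConvexMap h T S) {P : ℂ → ℂ}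
    (hP : ∀ z ∈ ball (0 : ℂ) 1, HasDerivAt P (dslope h 0 z) z) {z : ℂ} (hz : z ∈ ball (0 : ℂ) 1) :
    DifferentiableAt ℂ (Function.invFunOn P (ball 0 1)) (P z) := by
  refine ((hasStrictDerivAt_of_forall_hasDerivAt isOpen_ball hP hz).to_local_left_inverse
    (H.dslope_ne_zero hz) ?_).hasDerivAt.differentiableAt
  filter_upwards [isOpen_ball.mem_nhds hz] with x hx
  exact (H.injOn_primitive hP).leftInvOn_invFunOn hx

/-- If `g = P ∘ ω` on a disc of radius `r ≤ 1` and `z g'(z)` takes values in `S`, then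
`‖ω z‖ ≤ ‖z‖`. -/
lemma norm_le_of_eq_comp (H : IsConvexMap h T S) {P : ℂ → ℂ}
    (hP : ∀ z ∈ ball (0 : ℂ) 1, HasDerivAt P (dslope h 0 z) z) {g ω : ℂ → ℂ}
    (hg : DifferentiableOn ℂ g (ball 0 1))
    (hgS : ∀ z ∈ ball (0 : ℂ) 1, z * deriv g z ∈ S) {r : ℝ} (hr : r ≤ 1)
    (hω : DifferentiableOn ℂ ω (ball 0 r)) (hω0 : ω 0 = 0)
    (hω1 : MapsTo ω (ball 0 r) (ball 0 1)) (hgω : ∀ z ∈ ball (0 : ℂ) r, g z = P (ω z)) :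
    ∀ z ∈ ball (0 : ℂ) r, ‖ω z‖ ≤ ‖z‖ := by
  intro z hz
  have hzr : ‖z‖ < r := by simpa using hz
  obtain ⟨ρ, hρz, hρr⟩ := exists_between hzr
  have hρ : 0 < ρ := (norm_nonneg z).trans_lt hρz
  have hr0 : 0 < r := hρ.trans hρr
  have hvd : DifferentiableOn ℂ (dslope ω 0) (ball 0 r) :=
    (Complex.differentiableOn_dslope (ball_mem_nhds 0 hr0)).2 hω
  have hmulv : ∀ x, x * dslope ω 0 x = ω x := fun x => by
    simpa [hω0] using sub_smul_dslope ω 0 x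
  obtain ⟨z₀, hz₀, hmax⟩ := exists_mem_frontier_isMaxOn_norm (f := dslope ω 0)
    (isBounded_ball (x := (0 : ℂ)) (r := ρ)) (nonempty_ball.2 hρ)
    (DifferentiableOn.diffContOnCl (hvd.mono ((closure_ball (0 : ℂ) hρ.ne').subset.trans
      (closedBall_subset_ball hρr))))
  rw [frontier_ball (0 : ℂ) hρ.ne', mem_sphere_zero_iff_norm] at hz₀
  rw [closure_ball (0 : ℂ) hρ.ne'] at hmax
  have hz₀r : z₀ ∈ ball (0 : ℂ) r := by simpa [hz₀] using hρr
  have hz₀1 : z₀ ∈ ball (0 : ℂ) 1 := ball_subset_ball hr hz₀r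
  have hz₀ne : z₀ ≠ 0 := norm_pos_iff.1 (hz₀ ▸ hρ)
  have hmax' : ∀ x, ‖x‖ ≤ ‖z₀‖ → ‖dslope ω 0 x‖ ≤ ‖dslope ω 0 z₀‖ := fun x hx =>
    hmax (by simpa [← hz₀] using hx)
  suffices hone : ‖dslope ω 0 z₀‖ ≤ 1 by
    rw [← hmulv z, norm_mul]
    exact mul_le_of_le_one_right (norm_nonneg _) ((hmax' z (hz₀ ▸ hρz.le)).trans hone)
  by_cases hv0 : dslope ω 0 z₀ = 0
  · simp [hv0]
  have hvz₀ := hvd.differentiableAt (isOpen_ball.mem_nhds hz₀r)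
  obtain ⟨s, hs, hsv⟩ := exists_nonneg_mul_deriv_eq_of_norm_le hvz₀ hv0 hmax'
  have hωd : HasDerivAt ω ((1 + s) * dslope ω 0 z₀) z₀ := by
    have h1 := (hasDerivAt_id z₀).mul hvz₀.hasDerivAt
    have h2 : (id * dslope ω 0) = ω := funext hmulv
    rw [h2] at h1
    rwa [id, hsv, ← add_mul] at h1
  have hgd : HasDerivAt g (dslope h 0 (ω z₀) * ((1 + s) * dslope ω 0 z₀)) z₀ := by
    refine ((hP _ (hω1 hz₀r)).comp z₀ hωd).congr_of_eventuallyEq ?_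
    filter_upwards [isOpen_ball.mem_nhds hz₀r] with x hx using hgω x hx
  have hval : z₀ * deriv g z₀ = (1 + s) * h (ω z₀) := by
    rw [hgd.deriv, ← H.mul_dslope (ω z₀), ← hmulv z₀]
    ring
  have hs1 : (1 + s) ≠ 0 := by positivity
  have hs1' : (1 + s : ℂ) ≠ 0 := by exact_mod_cast hs1
  have hstar := H.norm_inv_smul_le (hgS z₀ hz₀1) (t := (1 + s)⁻¹)
    ⟨by positivity, inv_le_one_of_one_le₀ (by linarith)⟩
  have hcancel : (((1 + s)⁻¹ : ℝ) : ℂ) * (z₀ * deriv g z₀) = h (ω z₀) := by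
    rw [hval]; push_cast; field_simp
  rw [hcancel, H.left_inv _ (hω1 hz₀r)] at hstar
  have hschwarz := norm_le_norm_of_mapsTo_ball (f := fun z => T (z * deriv g z)) (R := 1)
    (z := z₀) (H.diff_inv.comp (differentiableOn_id.mul (hg.deriv isOpen_ball)) hgS)
    (fun x hx => ball_subset_closedBall (H.mapsTo_inv (hgS x hx)))
    (by simp [H.inv_zero]) (by simpa using hz₀1)
  have hle : ‖z₀‖ * ‖dslope ω 0 z₀‖ ≤ ‖z₀‖ := by
    rw [← norm_mul, hmulv]
    exact hstar.trans hschwarz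
  exact (mul_le_iff_le_one_right (norm_pos_iff.2 hz₀ne)).1 hle

/-- If `h` is a convex map, `z P' = h` and `z g' ≺ h`, then `g ≺ P`. -/
theorem subord_primitive (H : IsConvexMap h T S) {P : ℂ → ℂ}
    (hP : ∀ z ∈ ball (0 : ℂ) 1, HasDerivAt P (dslope h 0 z) z) (hP0 : P 0 = 0) {g : ℂ → ℂ}
    (hg : DifferentiableOn ℂ g (ball 0 1))
    (hg0 : g 0 = 0) (hgS : ∀ z ∈ ball (0 : ℂ) 1, z * deriv g z ∈ S) : Subord g P := by
  set Q := Function.invFunOn P (ball 0 1)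
  have hQP : ∀ x ∈ ball (0 : ℂ) 1, Q (P x) = x := (H.injOn_primitive hP).leftInvOn_invFunOn
  have hQ0 : Q (g 0) = 0 := by
    simpa [hg0, hP0] using hQP 0 (mem_ball_self one_pos)
  have hdiff : ∀ x ∈ ball (0 : ℂ) 1, g x ∈ P '' ball 0 1 → DifferentiableAt ℂ (Q ∘ g) x := by
    rintro x hx ⟨y, hy, hyx⟩
    refine DifferentiableAt.comp x ?_ (hg.differentiableAt (isOpen_ball.mem_nhds hx))
    rw [← hyx]
    exact H.differentiableAt_invFunOn hP hy
  have hmem : ∀ x, g x ∈ P '' ball 0 1 → Q (g x) ∈ ball (0 : ℂ) 1 := fun x hx =>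
    Function.invFunOn_mem hx
  have heq : ∀ x, g x ∈ P '' ball 0 1 → g x = P (Q (g x)) := fun x hx =>
    (Function.invFunOn_eq hx).symm
  suffices hall : ∀ z ∈ ball (0 : ℂ) 1, g z ∈ P '' ball 0 1 from
    ⟨Q ∘ g, fun z hz => (hdiff z hz (hall z hz)).differentiableWithinAt, hQ0,
      fun z hz => hmem z (hall z hz), fun z hz => heq z (hall z hz)⟩
  intro z hz
  by_contra hzP
  have hz1 : ‖z‖ < 1 := by simpa using hz
  have hsub : closedBall (0 : ℂ) ‖z‖ ⊆ ball 0 1 := closedBall_subset_ball hz1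
  have hK : IsCompact (closedBall (0 : ℂ) ‖z‖ ∩ g ⁻¹' (P '' ball 0 1)ᶜ) :=
    (isCompact_closedBall (0 : ℂ) ‖z‖).of_isClosed_subset
      ((hg.continuousOn.mono hsub).preimage_isClosed_of_isClosed isClosed_closedBall
        (H.isOpen_image_primitive hP).isClosed_compl) inter_subset_left
  have hzK : z ∈ closedBall (0 : ℂ) ‖z‖ ∩ g ⁻¹' (P '' ball 0 1)ᶜ := ⟨by simp, hzP⟩
  obtain ⟨z₁, ⟨hz₁, hz₁P⟩, hmin⟩ := hK.exists_isMinOn ⟨z, hzK⟩ continuous_norm.continuousOn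
  have hz₁le : ‖z₁‖ ≤ ‖z‖ := by simpa using hz₁
  have hz₁1 : ‖z₁‖ < 1 := hz₁le.trans_lt hz1
  have hlt : ∀ x ∈ ball (0 : ℂ) ‖z₁‖, g x ∈ P '' ball 0 1 := by
    intro x hx
    by_contra hxP
    have hx' : ‖x‖ < ‖z₁‖ := by simpa using hx
    exact hx'.not_ge (hmin ⟨by simpa using hx'.le.trans hz₁le, hxP⟩)
  have hball : ball (0 : ℂ) ‖z₁‖ ⊆ ball 0 1 := ball_subset_ball hz₁1.le
  have hbound := H.norm_le_of_eq_comp hP hg hgS hz₁1.le (ω := Q ∘ g)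
    (fun x hx => (hdiff x (hball hx) (hlt x hx)).differentiableWithinAt) hQ0
    (fun x hx => hmem x (hlt x hx)) (fun x hx => heq x (hlt x hx))
  have hsub₁ : closedBall (0 : ℂ) ‖z₁‖ ⊆ ball 0 1 := closedBall_subset_ball hz₁1
  have hclosed : IsClosed (P '' closedBall 0 ‖z₁‖) :=
    ((isCompact_closedBall _ _).image_of_continuousOn
      fun x hx => (hP x (hsub₁ hx)).continuousAt.continuousWithinAt).isClosed
  have hpath : Tendsto (fun t : ℝ => g (t * z₁)) (𝓝[<] 1) (𝓝 (g z₁)) := by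
    have hc : ContinuousAt g (((1 : ℝ) : ℂ) * z₁) := by
      rw [ofReal_one, one_mul]
      exact (hg.differentiableAt (isOpen_ball.mem_nhds (hsub hz₁))).continuousAt
    have hl : ContinuousAt (fun t : ℝ => (t : ℂ) * z₁) 1 := by fun_prop
    simpa [Function.comp_def] using
      (hc.comp_of_eq hl rfl).tendsto.mono_left nhdsWithin_le_nhds
  have hz₁ne : 0 < ‖z₁‖ := by
    refine norm_pos_iff.2 fun h0 => hz₁P ⟨0, mem_ball_self one_pos, ?_⟩
    rw [h0, hg0, hP0]
  have hlim : g z₁ ∈ P '' closedBall 0 ‖z₁‖ := by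
    refine hclosed.mem_of_tendsto hpath ?_
    filter_upwards [Ioo_mem_nhdsLT (zero_lt_one' ℝ)] with t ht
    have hlt' : ‖(t : ℂ) * z₁‖ < ‖z₁‖ := by
      rw [norm_mul, norm_real, Real.norm_of_nonneg ht.1.le]
      exact mul_lt_of_lt_one_left hz₁ne ht.2
    have hin : (t : ℂ) * z₁ ∈ ball (0 : ℂ) ‖z₁‖ := by simpa using hlt'
    exact ⟨Q (g (t * z₁)), by simpa using (hbound _ hin).trans hlt'.le,
      (heq _ (hlt _ hin)).symm⟩
  exact hz₁P (image_mono hsub₁ hlim)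

end IsConvexMap

lemma exp_I_mul_mul_exp_neg_I_mul (δ : ℝ) :
    Complex.exp (I * δ) * Complex.exp (-I * δ) = 1 := by
  rw [← Complex.exp_add]
  simp

lemma norm_exp_I_mul (δ : ℝ) : ‖Complex.exp (I * δ)‖ = 1 := by
  rw [mul_comm, Complex.norm_exp_ofReal_mul_I]

lemma norm_exp_neg_I_mul (δ : ℝ) : ‖Complex.exp (-I * δ)‖ = 1 := by
  simpa using norm_exp_I_mul (-δ)

lemma one_add_mul_ne_zero {z c : ℂ} (hz : ‖z‖ < 1) (hc : ‖c‖ = 1) : 1 + z * c ≠ 0 := by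
  intro h
  have h1 : ‖z * c‖ = 1 := by rw [eq_neg_of_add_eq_zero_right h]; simp
  rw [norm_mul, hc, mul_one] at h1
  exact hz.ne h1

/-- The vertical strip `(δ - π) / (2 sin δ) < Re w < δ / (2 sin δ)`. -/
def verticalStrip (δ : ℝ) : Set ℂ :=
  {w | (δ - Real.pi) / (2 * Real.sin δ) < w.re ∧ w.re < δ / (2 * Real.sin δ)}

/-- The inverse of `Bdelta δ`. -/
noncomputable def BdeltaInv (δ : ℝ) (w : ℂ) : ℂ :=
  (Complex.exp (2 * I * Real.sin δ * w) - 1) /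
    (Complex.exp (I * δ) - Complex.exp (2 * I * Real.sin δ * w) * Complex.exp (-I * δ))

/-- The Möbius map sending the unit disc onto the half-plane `δ - π < arg < δ`. -/
noncomputable def mobius (δ : ℝ) (z : ℂ) : ℂ :=
  (1 + z * Complex.exp (I * δ)) / (1 + z * Complex.exp (-I * δ))

lemma mobius_ne_zero (δ : ℝ) {z : ℂ} (hz : ‖z‖ < 1) : mobius δ z ≠ 0 :=
  div_ne_zero (one_add_mul_ne_zero hz (norm_exp_I_mul δ))
    (one_add_mul_ne_zero hz (norm_exp_neg_I_mul δ))

lemma mem_verticalStrip_iff {δ : ℝ} (hδ0 : 0 < δ) (hδπ : δ < Real.pi) {w : ℂ} :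
    w ∈ verticalStrip δ ↔
    δ - Real.pi < (2 * I * Real.sin δ * w).im ∧ (2 * I * Real.sin δ * w).im < δ := by
  have hs : 0 < 2 * Real.sin δ := by linarith [Real.sin_pos_of_pos_of_lt_pi hδ0 hδπ]
  have : (2 * I * Real.sin δ * w).im = w.re * (2 * Real.sin δ) := by
    rw [show 2 * I * (Real.sin δ : ℂ) * w = ((2 * Real.sin δ : ℝ) : ℂ) * (w * I) by
      push_cast; ring, Complex.im_ofReal_mul, Complex.mul_I_im]
    ring
  rw [verticalStrip, mem_ofPred_eq, div_lt_iff₀ hs, lt_div_iff₀ hs, this]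

lemma two_I_mul_sin_ne_zero {δ : ℝ} (hδ0 : 0 < δ) (hδπ : δ < Real.pi) :
    2 * I * (Real.sin δ : ℂ) ≠ 0 := by
  have := (Real.sin_pos_of_pos_of_lt_pi hδ0 hδπ).ne'
  simpa [← Complex.ofReal_sin] using this

lemma norm_exp_sub_one_lt {δ : ℝ} (hδ0 : 0 < δ) (hδπ : δ < Real.pi) {u : ℂ}
    (h1 : δ - Real.pi < u.im) (h2 : u.im < δ) :
    ‖Complex.exp u - 1‖ <
      ‖Complex.exp (I * δ) - Complex.exp u * Complex.exp (-I * δ)‖ := by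
  have hs := Real.sin_pos_of_pos_of_lt_pi hδ0 hδπ
  have hsin : Real.sin (u.im - δ) < 0 :=
    Real.sin_neg_of_neg_of_neg_pi_lt (by linarith) (by linarith)
  have hre : (Complex.exp u).re = Real.exp u.re * Real.cos u.im := Complex.exp_re u
  have him : (Complex.exp u).im = Real.exp u.re * Real.sin u.im := Complex.exp_im u
  have hc : Complex.exp (I * δ) = ⟨Real.cos δ, Real.sin δ⟩ := by
    apply Complex.ext <;> simp [Complex.exp_re, Complex.exp_im]
  have hc' : Complex.exp (-I * δ) = ⟨Real.cos δ, -Real.sin δ⟩ := by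
    apply Complex.ext <;> simp [Complex.exp_re, Complex.exp_im]
  have hprod : 0 < Real.exp u.re * (Real.sin δ * -Real.sin (u.im - δ)) :=
    mul_pos (Real.exp_pos _) (mul_pos hs (by linarith))
  rw [Real.sin_sub] at hprod
  refine lt_of_pow_lt_pow_left₀ 2 (norm_nonneg _) ?_
  rw [← Complex.normSq_eq_norm_sq, ← Complex.normSq_eq_norm_sq, Complex.normSq_apply,
    Complex.normSq_apply, hc, hc']
  simp only [sub_re, sub_im, mul_re, mul_im, one_re, one_im, hre, him]
  have hcs := Real.sin_sq_add_cos_sq δ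
  set e := Real.exp u.re
  set a := Real.cos u.im
  set b := Real.sin u.im
  set x := Real.cos δ
  set y := Real.sin δ
  have key : (x - (e * a * x - e * b * -y)) * (x - (e * a * x - e * b * -y)) +
      (y - (e * a * -y + e * b * x)) * (y - (e * a * -y + e * b * x)) -
      ((e * a - 1) * (e * a - 1) + (e * b - 0) * (e * b - 0)) =
      4 * (e * (y * -(b * x - a * y))) := by
    linear_combination (1 + e ^ 2 * (a ^ 2 + b ^ 2) - 2 * e * a) * hcs
  linarith

lemma exp_sub_exp_mul_ne_zero {δ : ℝ} (hδ0 : 0 < δ) (hδπ : δ < Real.pi) {w : ℂ}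
    (hw : w ∈ verticalStrip δ) :
    Complex.exp (I * δ) -
      Complex.exp (2 * I * Real.sin δ * w) * Complex.exp (-I * δ) ≠ 0 := by
  obtain ⟨h1, h2⟩ := (mem_verticalStrip_iff hδ0 hδπ).1 hw
  exact norm_pos_iff.1 ((norm_nonneg _).trans_lt (norm_exp_sub_one_lt hδ0 hδπ h1 h2))

lemma mapsTo_BdeltaInv {δ : ℝ} (hδ0 : 0 < δ) (hδπ : δ < Real.pi) :
    MapsTo (BdeltaInv δ) (verticalStrip δ) (ball 0 1) := by
  intro w hw
  obtain ⟨h1, h2⟩ := (mem_verticalStrip_iff hδ0 hδπ).1 hw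
  rw [mem_ball_zero_iff, BdeltaInv, norm_div,
    div_lt_one (norm_pos_iff.2 (exp_sub_exp_mul_ne_zero hδ0 hδπ hw))]
  exact norm_exp_sub_one_lt hδ0 hδπ h1 h2

lemma differentiableOn_BdeltaInv {δ : ℝ} (hδ0 : 0 < δ) (hδπ : δ < Real.pi) :
    DifferentiableOn ℂ (BdeltaInv δ) (verticalStrip δ) := by
  refine DifferentiableOn.div ?_ ?_ fun w hw => exp_sub_exp_mul_ne_zero hδ0 hδπ hw <;> fun_prop

lemma arg_mobius {δ : ℝ} (hδ0 : 0 < δ) (hδπ : δ < Real.pi) {z : ℂ} (hz : ‖z‖ < 1) :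
    δ - Real.pi < (mobius δ z).arg ∧ (mobius δ z).arg < δ := by
  have hs := Real.sin_pos_of_pos_of_lt_pi hδ0 hδπ
  have hden := one_add_mul_ne_zero hz (norm_exp_neg_I_mul δ)
  have hconj : conj (1 + z * Complex.exp (-I * δ)) = 1 + conj z * Complex.exp (I * δ) := by
    simp [← Complex.exp_conj]
  have hX : mobius δ z * Complex.exp (-I * δ) =
      ((normSq (1 + z * Complex.exp (-I * δ)))⁻¹ : ℝ) *
        (Complex.exp (-I * δ) + (z + conj z) + (normSq z : ℝ) * Complex.exp (I * δ)) := by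
    have hconj0 : 1 + conj z * Complex.exp (I * δ) ≠ 0 := by
      rw [← hconj]; exact (map_ne_zero _).2 hden
    push_cast
    rw [Complex.normSq_eq_conj_mul_self (z := z), Complex.normSq_eq_conj_mul_self, hconj, mobius]
    have hmul := exp_I_mul_mul_exp_neg_I_mul δ
    generalize Complex.exp (I * δ) = c at *
    generalize Complex.exp (-I * δ) = d at *
    generalize conj z = w at *
    rw [mul_comm] at hconj0
    field_simp
    linear_combination (z + w + z * w * c) * hmul
  have him : (mobius δ z * Complex.exp (-I * δ)).im < 0 := by
    rw [hX, im_ofReal_mul]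
    refine mul_neg_of_pos_of_neg (inv_pos.2 (normSq_pos.2 hden)) ?_
    have hz2 : normSq z < 1 := by
      rw [Complex.normSq_eq_norm_sq]
      exact pow_lt_one₀ (norm_nonneg _) hz two_ne_zero
    simp only [add_im, im_ofReal_mul, conj_im]
    simp [Complex.exp_im]
    nlinarith
  have hpolar : mobius δ z * Complex.exp (-I * δ) =
      ‖mobius δ z‖ * Complex.exp (((mobius δ z).arg - δ : ℝ) * I) := by
    nth_rewrite 1 [← Complex.norm_mul_exp_arg_mul_I (mobius δ z)]
    rw [mul_assoc, ← Complex.exp_add]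
    congr 2
    push_cast
    ring
  rw [hpolar, im_ofReal_mul, Complex.exp_ofReal_mul_I_im] at him
  have hsin : Real.sin ((mobius δ z).arg - δ) < 0 := by
    by_contra! h
    exact him.not_ge (mul_nonneg (norm_nonneg _) h)
  have h1 := Complex.neg_pi_lt_arg (mobius δ z)
  have h2 := Complex.arg_le_pi (mobius δ z)
  constructor
  · by_contra! h
    have := Real.sin_nonneg_of_nonneg_of_le_pi (x := (mobius δ z).arg - δ + 2 * Real.pi)
      (by linarith) (by linarith)
    rw [Real.sin_add_two_pi] at this
    linarith
  · by_contra! h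
    have := Real.sin_nonneg_of_nonneg_of_le_pi (x := (mobius δ z).arg - δ)
      (by linarith) (by linarith)
    linarith

lemma two_I_mul_sin_mul_Bdelta {δ : ℝ} (hδ0 : 0 < δ) (hδπ : δ < Real.pi) (z : ℂ) :
    2 * I * Real.sin δ * Bdelta δ z = Complex.log (mobius δ z) := by
  rw [Bdelta, mobius, ← mul_assoc, mul_one_div_cancel (two_I_mul_sin_ne_zero hδ0 hδπ), one_mul]

lemma mapsTo_Bdelta {δ : ℝ} (hδ0 : 0 < δ) (hδπ : δ < Real.pi) :
    MapsTo (Bdelta δ) (ball 0 1) (verticalStrip δ) := by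
  intro z hz
  rw [mem_verticalStrip_iff hδ0 hδπ, two_I_mul_sin_mul_Bdelta hδ0 hδπ, Complex.log_im]
  exact arg_mobius hδ0 hδπ (by simpa using hz)

lemma differentiableOn_Bdelta {δ : ℝ} (hδ0 : 0 < δ) (hδπ : δ < Real.pi) :
    DifferentiableOn ℂ (Bdelta δ) (ball 0 1) := by
  have hd : DifferentiableOn ℂ (mobius δ) (ball 0 1) := by
    refine DifferentiableOn.div (by fun_prop) (by fun_prop) fun z hz => ?_
    exact one_add_mul_ne_zero (by simpa using hz) (norm_exp_neg_I_mul δ)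
  refine (hd.clog fun z hz => ?_).const_mul _
  have hz' : ‖z‖ < 1 := by simpa using hz
  exact Complex.mem_slitPlane_iff_arg.2
    ⟨((arg_mobius hδ0 hδπ hz').2.trans hδπ).ne, mobius_ne_zero δ hz'⟩

lemma BdeltaInv_Bdelta {δ : ℝ} (hδ0 : 0 < δ) (hδπ : δ < Real.pi) {z : ℂ} (hz : z ∈ ball (0 : ℂ) 1) :
    BdeltaInv δ (Bdelta δ z) = z := by
  have hD := exp_sub_exp_mul_ne_zero hδ0 hδπ (mapsTo_Bdelta hδ0 hδπ hz)
  have hz' : ‖z‖ < 1 := by simpa using hz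
  rw [two_I_mul_sin_mul_Bdelta hδ0 hδπ, Complex.exp_log (mobius_ne_zero δ hz')] at hD
  rw [BdeltaInv, two_I_mul_sin_mul_Bdelta hδ0 hδπ,
    Complex.exp_log (mobius_ne_zero δ hz'), div_eq_iff hD]
  have hden := one_add_mul_ne_zero hz' (norm_exp_neg_I_mul δ)
  have hX : mobius δ z * (1 + z * Complex.exp (-I * δ)) = 1 + z * Complex.exp (I * δ) :=
    div_mul_cancel₀ _ hden
  linear_combination hX

lemma Bdelta_BdeltaInv {δ : ℝ} (hδ0 : 0 < δ) (hδπ : δ < Real.pi) {w : ℂ}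
    (hw : w ∈ verticalStrip δ) : Bdelta δ (BdeltaInv δ w) = w := by
  have hD := exp_sub_exp_mul_ne_zero hδ0 hδπ hw
  obtain ⟨h1, h2⟩ := (mem_verticalStrip_iff hδ0 hδπ).1 hw
  have hne := two_I_mul_sin_ne_zero hδ0 hδπ
  have hX : mobius δ (BdeltaInv δ w) = Complex.exp (2 * I * Real.sin δ * w) := by
    have hz : ‖BdeltaInv δ w‖ < 1 := by simpa using mapsTo_BdeltaInv hδ0 hδπ hw
    rw [mobius, div_eq_iff (one_add_mul_ne_zero hz (norm_exp_neg_I_mul δ))]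
    have hT : BdeltaInv δ w * (Complex.exp (I * δ) -
        Complex.exp (2 * I * Real.sin δ * w) * Complex.exp (-I * δ)) =
        Complex.exp (2 * I * Real.sin δ * w) - 1 := div_mul_cancel₀ _ hD
    linear_combination hT
  refine mul_left_cancel₀ hne ?_
  rw [two_I_mul_sin_mul_Bdelta hδ0 hδπ, hX, Complex.log_exp (by linarith) (by linarith)]

lemma isConvexMap_Bdelta {δ : ℝ} (hδ0 : 0 < δ) (hδπ : δ < Real.pi) :
    IsConvexMap (Bdelta δ) (BdeltaInv δ) (verticalStrip δ) where
  isOpen := (isOpen_lt continuous_const continuous_re).inter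
    (isOpen_lt continuous_re continuous_const)
  convex := (convex_halfSpace_re_gt _).inter (convex_halfSpace_re_lt _)
  map_zero := by simp [Bdelta]
  diff := differentiableOn_Bdelta hδ0 hδπ
  mapsTo := mapsTo_Bdelta hδ0 hδπ
  diff_inv := differentiableOn_BdeltaInv hδ0 hδπ
  mapsTo_inv := mapsTo_BdeltaInv hδ0 hδπ
  left_inv _ := BdeltaInv_Bdelta hδ0 hδπ
  right_inv _ := Bdelta_BdeltaInv hδ0 hδπ

/-- `Btilde δ` is the primitive of `Bdelta δ z / z` vanishing at `0`. -/
lemma Btilde_eq_of_hasDerivAt {δ : ℝ} (hδ0 : 0 < δ) (hδπ : δ < Real.pi) {P : ℂ → ℂ} (hP0 : P 0 = 0)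
    (hP : ∀ z ∈ ball (0 : ℂ) 1, HasDerivAt P (dslope (Bdelta δ) 0 z) z) {z : ℂ}
    (hz : z ∈ ball (0 : ℂ) 1) : Btilde δ z = P z := by
  have H := isConvexMap_Bdelta hδ0 hδπ
  have hmem : ∀ t ∈ uIcc (0 : ℝ) 1, (t : ℂ) * z ∈ ball (0 : ℂ) 1 := fun t ht => by
    rw [uIcc_of_le zero_le_one] at ht
    simpa using (convex_ball (0 : ℂ) 1).smul_mem_of_zero_mem (mem_ball_self one_pos) hz ht
  have hline : ∀ t : ℝ, HasDerivAt (fun t : ℝ => (t : ℂ) * z) z t := fun t => by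
    simpa using ((hasDerivAt_id t).ofReal_comp).mul_const z
  have hFTC := intervalIntegral.integral_eq_sub_of_hasDerivAt
    (fun t ht => (hP _ (hmem t ht)).comp t (hline t))
    (ContinuousOn.intervalIntegrable
      ((H.differentiableOn_dslope.continuousOn.comp (by fun_prop) hmem).mul continuousOn_const))
  simp only [Function.comp, ofReal_one, one_mul, ofReal_zero, zero_mul, hP0, sub_zero] at hFTC
  rw [← hFTC, Btilde]
  refine intervalIntegral.integral_congr_ae (Eventually.of_forall fun t ht => ?_)
  rw [uIoc_of_le zero_le_one] at ht
  by_cases hz0 : z = 0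
  · simp [hz0]
  have htz : (t : ℂ) * z ≠ 0 := mul_ne_zero (ofReal_ne_zero.2 ht.1.ne') hz0
  rw [← H.mul_dslope (t * z), mul_div_cancel_left₀ _ htz]

theorem subord_Btilde {δ : ℝ} (hδ0 : 0 < δ) (hδπ : δ < Real.pi) {g : ℂ → ℂ}
    (hg : DifferentiableOn ℂ g (ball 0 1)) (hg0 : g 0 = 0)
    (hgS : ∀ z ∈ ball (0 : ℂ) 1, z * deriv g z ∈ verticalStrip δ) : Subord g (Btilde δ) := by
  have H := isConvexMap_Bdelta hδ0 hδπ
  obtain ⟨P, hP0, hP⟩ := (H.differentiableOn_dslope.isExactOn_ball).with_val_at 0 0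
  obtain ⟨ω, hω, hω0, hω1, hgω⟩ := H.subord_primitive hP hP0 hg hg0 hgS
  exact ⟨ω, hω, hω0, hω1, fun z hz => by
    rw [hgω z hz, Btilde_eq_of_hasDerivAt hδ0 hδπ hP0 hP (hω1 z hz)]⟩

/-- If `exp g = f z / z` then `z g' = z f' / f - 1`. -/
lemma mul_deriv_of_exp_eq_div {f g : ℂ → ℂ} {U : Set ℂ} (hU : IsOpen U)
    (hg : DifferentiableOn ℂ g U) (hgf : ∀ z ∈ U, z ≠ 0 → Complex.exp (g z) = f z / z) {z : ℂ}
    (hz : z ∈ U) (hz0 : z ≠ 0) : z * deriv g z = z * deriv f z / f z - 1 := by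
  have hgz := (hg.differentiableAt (hU.mem_nhds hz)).hasDerivAt
  have hEq : f =ᶠ[𝓝 z] fun x => Complex.exp (g x) * x := by
    filter_upwards [hU.mem_nhds hz, isOpen_ne.mem_nhds hz0] with x hx hx0
    rw [hgf x hx hx0, div_mul_cancel₀ _ hx0]
  have hd := (hgz.cexp.mul (hasDerivAt_id z)).congr_of_eventuallyEq hEq
  rw [hd.deriv, hEq.eq_of_nhds]
  have := Complex.exp_ne_zero (g z)
  simp only [id]
  field_simp
  ring

end

/-- If `f ∈ M(δ)`, then (any analytic branch of) `log(f(z)/z)` is subordinate to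
`B̃_δ(z) = ∫₀^z B_δ(t)/t dt`. -/
theorem log_f_div_z_subordinate_Btilde (δ : ℝ) (hδ1 : Real.pi / 2 ≤ δ) (hδ2 : δ < Real.pi)
    (f : ℂ → ℂ) (hf : DifferentiableOn ℂ f (ball 0 1))
    (hf0 : f 0 = 0) (hf1 : deriv f 0 = 1)
    (hfz : ∀ z ∈ ball (0 : ℂ) 1, z ≠ 0 → f z ≠ 0)
    (hM : ∀ z ∈ ball (0 : ℂ) 1, z ≠ 0 →
      1 + (δ - Real.pi) / (2 * Real.sin δ) < (z * deriv f z / f z).re ∧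
      (z * deriv f z / f z).re < 1 + δ / (2 * Real.sin δ))
    (g : ℂ → ℂ) (hg : DifferentiableOn ℂ g (ball 0 1)) (hg0 : g 0 = 0)
    (hgf : ∀ z ∈ ball (0 : ℂ) 1, z ≠ 0 → Complex.exp (g z) = f z / z) :
    Subord g (Btilde δ) := by
  have hδ0 : 0 < δ := by linarith [Real.pi_pos]
  refine subord_Btilde hδ0 hδ2 hg hg0 fun z hz => ?_
  by_cases hz0 : z = 0
  · rw [hz0, zero_mul]
    exact (isConvexMap_Bdelta hδ0 hδ2).zero_mem
  · rw [mul_deriv_of_exp_eq_div isOpen_ball hg hgf hz hz0]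
    obtain ⟨h1, h2⟩ := hM z hz hz0
    constructor <;> rw [Complex.sub_re, Complex.one_re] <;> linarith
end

section
/- If f ∈ M(δ) with π/2 ≤ δ < π, then the logarithmic coefficients γ_n of f satisfy Σ_{n=1}^∞ |γ_n|² ≤ (1/(16 sin² δ)) (π⁴/45 - Li₄(e^{-2iδ}) - Li₄(e^{2iδ})), where Li₄(z) = Σ_{n≥1} zⁿ/n⁴. -/
open Complex Metric

/-- The polylogarithm of order 4, `Li₄(z) = Σ_{n≥1} zⁿ/n⁴`. -/
noncomputable def Li4 (z : ℂ) : ℂ := ∑' n : ℕ, z ^ (n + 1) / ((n : ℂ) + 1) ^ 4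

lemma circleIntegrable_norm_sq {F : ℂ → ℂ} (hF : DifferentiableOn ℂ F (ball 0 1)) {r : ℝ}
    (hr0 : 0 ≤ r) (hr1 : r < 1) : CircleIntegrable (fun z => ‖F z‖ ^ 2) 0 r :=
  ((hF.continuousOn.mono (sphere_subset_closedBall.trans (closedBall_subset_ball hr1))).norm.pow
    2).circleIntegrable hr0

lemma circleAverage_norm_sq_const_add {F : ℂ → ℂ} (hF : DifferentiableOn ℂ F (ball 0 1))
    (hF0 : F 0 = 0) {r : ℝ} (hr0 : 0 ≤ r) (hr1 : r < 1) (c : ℂ) :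
    Real.circleAverage (fun z => ‖c + F z‖ ^ 2) 0 r =
      ‖c‖ ^ 2 + Real.circleAverage (fun z => ‖F z‖ ^ 2) 0 r := by
  have hcF : DifferentiableOn ℂ (fun z => 2 * (starRingEnd ℂ) c * F z) (ball 0 1) :=
    hF.const_mul _
  have hcI : CircleIntegrable (fun z => 2 * (starRingEnd ℂ) c * F z) 0 r :=
    (hcF.continuousOn.mono
      (sphere_subset_closedBall.trans (closedBall_subset_ball hr1))).circleIntegrable hr0
  have hmean : Real.circleAverage (fun z => (2 * (starRingEnd ℂ) c * F z).re) 0 r = 0 := by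
    have h1 := Complex.reCLM.circleAverage_comp_comm hcI
    have h2 : Real.circleAverage (fun z => 2 * (starRingEnd ℂ) c * F z) 0 r = 0 := by
      rw [DiffContOnCl.circleAverage, hF0, mul_zero]
      rw [abs_of_nonneg hr0]
      exact (hcF.mono ((closure_ball_subset_closedBall).trans
        (closedBall_subset_ball hr1))).diffContOnCl
    rw [h2, map_zero] at h1
    exact h1
  have hre : CircleIntegrable (fun z => (2 * (starRingEnd ℂ) c * F z).re) 0 r :=
    (Complex.continuous_re.comp_continuousOn (hcF.continuousOn.mono
      (sphere_subset_closedBall.trans (closedBall_subset_ball hr1)))).circleIntegrable hr0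
  have hexp : (fun z => ‖c + F z‖ ^ 2) =
      fun z => (‖c‖ ^ 2 + (2 * (starRingEnd ℂ) c * F z).re) + ‖F z‖ ^ 2 := by
    funext z
    simp only [Complex.sq_norm, Complex.normSq_apply, Complex.add_re, Complex.add_im,
      Complex.mul_re, Complex.mul_im, Complex.conj_re, Complex.conj_im, Complex.re_ofNat,
      Complex.im_ofNat]
    ring
  rw [hexp, Real.circleAverage_fun_add _ (circleIntegrable_norm_sq hF hr0 hr1),
    Real.circleAverage_fun_add (circleIntegrable_const _ _ _) hre, hmean,
    Real.circleAverage_const, add_zero]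
  exact (circleIntegrable_const _ _ _).add hre

lemma circleAverage_norm_sq_id_mul (F : ℂ → ℂ) (r : ℝ) :
    Real.circleAverage (fun z => ‖z * F z‖ ^ 2) 0 r =
      r ^ 2 * Real.circleAverage (fun z => ‖F z‖ ^ 2) 0 r := by
  rw [← smul_eq_mul, ← Real.circleAverage_fun_smul]
  refine Real.circleAverage_congr_sphere fun z hz => ?_
  have : ‖z‖ = |r| := by simpa using hz
  simp [mul_pow, this]

/-- Bessel's inequality for the Taylor coefficients on a circle of radius `r < 1`. -/
lemma sum_norm_sq_mul_pow_le_circleAverage {R : ℂ → ℂ} (hR : DifferentiableOn ℂ R (ball 0 1))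
    {r : ℝ} (hr0 : 0 ≤ r) (hr1 : r < 1) (n : ℕ) (a : ℕ → ℂ) :
    ∑ k ∈ Finset.range n, ‖a k‖ ^ 2 * r ^ (2 * k) ≤
      Real.circleAverage (fun z => ‖∑ k ∈ Finset.range n, a k * z ^ k + z ^ n * R z‖ ^ 2) 0 r := by
  induction n generalizing a with
  | zero =>
    simpa using Real.circleAverage_nonneg_of_nonneg (fun z _ => by positivity)
  | succ n ih =>
    have hG : DifferentiableOn ℂ
        (fun z => ∑ k ∈ Finset.range n, a (k + 1) * z ^ k + z ^ n * R z) (ball 0 1) := by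
      fun_prop
    have hzG : DifferentiableOn ℂ
        (fun z => z * (∑ k ∈ Finset.range n, a (k + 1) * z ^ k + z ^ n * R z)) (ball 0 1) :=
      differentiableOn_id.mul hG
    have hexp : (fun z => ‖∑ k ∈ Finset.range (n + 1), a k * z ^ k + z ^ (n + 1) * R z‖ ^ 2) =
        fun z => ‖a 0 + z * (∑ k ∈ Finset.range n, a (k + 1) * z ^ k + z ^ n * R z)‖ ^ 2 := by
      funext z
      rw [Finset.sum_range_succ', mul_add, Finset.mul_sum]
      congr 2
      simp only [pow_succ, pow_zero, mul_one]
      rw [Finset.sum_congr rfl fun k _ => show a (k + 1) * (z ^ k * z) = z * (a (k + 1) * z ^ k) by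
        ring]
      ring
    rw [hexp, circleAverage_norm_sq_const_add hzG (by simp) hr0 hr1,
      circleAverage_norm_sq_id_mul, Finset.sum_range_succ']
    have h := mul_le_mul_of_nonneg_left (ih fun k => a (k + 1)) (sq_nonneg r)
    rw [Finset.mul_sum] at h
    rw [Finset.sum_congr rfl fun k _ => show ‖a (k + 1)‖ ^ 2 * r ^ (2 * (k + 1)) =
      r ^ 2 * (‖a (k + 1)‖ ^ 2 * r ^ (2 * k)) by ring]
    simp only [mul_zero, pow_zero, mul_one]
    linarith

/-- **Littlewood's subordination inequality** for polynomials. -/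
lemma circleAverage_norm_sq_polynomial_comp_le {w : ℂ → ℂ} (hw : DifferentiableOn ℂ w (ball 0 1))
    (hw0 : w 0 = 0) (hwle : ∀ z ∈ ball (0 : ℂ) 1, ‖w z‖ ≤ ‖z‖)
    {r : ℝ} (hr0 : 0 ≤ r) (hr1 : r < 1) (n : ℕ) (b : ℕ → ℂ) :
    Real.circleAverage (fun z => ‖∑ k ∈ Finset.range n, b k * w z ^ k‖ ^ 2) 0 r ≤
      ∑ k ∈ Finset.range n, ‖b k‖ ^ 2 * r ^ (2 * k) := by
  induction n generalizing b with
  | zero => simp [Real.circleAverage_const]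
  | succ n ih =>
    have hG : DifferentiableOn ℂ
        (fun z => ∑ k ∈ Finset.range n, b (k + 1) * w z ^ k) (ball 0 1) := by
      fun_prop
    have hwG : DifferentiableOn ℂ
        (fun z => w z * (∑ k ∈ Finset.range n, b (k + 1) * w z ^ k)) (ball 0 1) := hw.mul hG
    have hexp : (fun z => ‖∑ k ∈ Finset.range (n + 1), b k * w z ^ k‖ ^ 2) =
        fun z => ‖b 0 + w z * (∑ k ∈ Finset.range n, b (k + 1) * w z ^ k)‖ ^ 2 := by
      funext z
      rw [Finset.sum_range_succ', Finset.mul_sum]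
      simp only [pow_succ, pow_zero, mul_one]
      rw [Finset.sum_congr rfl fun k _ =>
        show b (k + 1) * (w z ^ k * w z) = w z * (b (k + 1) * w z ^ k) by ring, add_comm]
    have hmono : Real.circleAverage
        (fun z => ‖w z * (∑ k ∈ Finset.range n, b (k + 1) * w z ^ k)‖ ^ 2) 0 r ≤
        Real.circleAverage
        (fun z => ‖z * (∑ k ∈ Finset.range n, b (k + 1) * w z ^ k)‖ ^ 2) 0 r := by
      refine Real.circleAverage_mono (circleIntegrable_norm_sq hwG hr0 hr1)
        (circleIntegrable_norm_sq (differentiableOn_id.mul hG) hr0 hr1) fun z hz => ?_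
      have hzr : ‖z‖ = r := by simpa [abs_of_nonneg hr0] using hz
      have := hwle z (by simpa [hzr] using hr1)
      simp only [norm_mul]
      gcongr
    rw [circleAverage_norm_sq_id_mul] at hmono
    rw [hexp, circleAverage_norm_sq_const_add hwG (by simp [hw0]) hr0 hr1,
      Finset.sum_range_succ']
    have h := mul_le_mul_of_nonneg_left (ih fun k => b (k + 1)) (sq_nonneg r)
    rw [Finset.mul_sum] at h
    rw [Finset.sum_congr rfl fun k _ => show ‖b (k + 1)‖ ^ 2 * r ^ (2 * (k + 1)) =
      r ^ 2 * (‖b (k + 1)‖ ^ 2 * r ^ (2 * k)) by ring]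
    simp only [mul_zero, pow_zero, mul_one]
    linarith

lemma summable_norm_mul_pow {a : ℕ → ℂ} {G : ℂ → ℂ}
    (h : ∀ z ∈ ball (0 : ℂ) 1, HasSum (fun k => a k * z ^ k) (G z)) {ρ : ℝ} (hρ0 : 0 ≤ ρ)
    (hρ1 : ρ < 1) : Summable fun k => ‖a k‖ * ρ ^ k := by
  have := (h ρ (by simpa [abs_of_nonneg hρ0] using hρ1)).summable.norm
  simpa [abs_of_nonneg hρ0] using this

lemma differentiableOn_tsum_pow {a : ℕ → ℂ}
    (h : ∀ ρ : ℝ, 0 < ρ → ρ < 1 → Summable fun k => ‖a k‖ * ρ ^ k) :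
    DifferentiableOn ℂ (fun z => ∑' k, a k * z ^ k) (ball 0 1) := by
  intro z hz
  obtain ⟨ρ, hzρ, hρ1⟩ := exists_between (mem_ball_zero_iff.mp hz)
  have hρ0 : 0 < ρ := (norm_nonneg z).trans_lt hzρ
  refine DifferentiableAt.differentiableWithinAt ?_
  refine (differentiableOn_tsum_of_summable_norm (h ρ hρ0 hρ1) (fun i => by fun_prop)
    (isOpen_ball (x := (0 : ℂ)) (ε := ρ)) fun i w hw => ?_).differentiableAt
    (isOpen_ball.mem_nhds (by simpa using hzρ))
  rw [norm_mul, norm_pow]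
  have := (mem_ball_zero_iff.mp hw).le
  gcongr

lemma exists_taylor_remainder {a : ℕ → ℂ} {G : ℂ → ℂ}
    (h : ∀ z ∈ ball (0 : ℂ) 1, HasSum (fun k => a k * z ^ k) (G z)) (n : ℕ) :
    ∃ R : ℂ → ℂ, DifferentiableOn ℂ R (ball 0 1) ∧ ∀ z ∈ ball (0 : ℂ) 1,
      G z = ∑ k ∈ Finset.range n, a k * z ^ k + z ^ n * R z := by
  refine ⟨fun z => ∑' k, a (k + n) * z ^ k, differentiableOn_tsum_pow fun ρ hρ0 hρ1 => ?_,
    fun z hz => ?_⟩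
  · have := ((summable_nat_add_iff n).mpr (summable_norm_mul_pow h hρ0.le hρ1)).mul_right
      ((ρ ^ n)⁻¹)
    refine this.congr fun k => ?_
    rw [pow_add]
    field_simp
  · rw [← (h z hz).tsum_eq, ← (h z hz).summable.sum_add_tsum_nat_add n, ← tsum_mul_left]
    congr 1
    exact tsum_congr fun k => by ring

/-- **Rogosinski's theorem**, for partial sums of the squared Taylor coefficients. -/
theorem sum_norm_sq_le_of_subordinate {a b : ℕ → ℂ} {g h w : ℂ → ℂ}
    (hg : ∀ z ∈ ball (0 : ℂ) 1, HasSum (fun k => a k * z ^ k) (g z))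
    (hh : ∀ z ∈ ball (0 : ℂ) 1, HasSum (fun k => b k * z ^ k) (h z))
    (hw : DifferentiableOn ℂ w (ball 0 1)) (hw0 : w 0 = 0)
    (hwb : Set.MapsTo w (ball 0 1) (ball 0 1)) (hgh : ∀ z ∈ ball (0 : ℂ) 1, g z = h (w z))
    (n : ℕ) :
    ∑ k ∈ Finset.range n, ‖a k‖ ^ 2 ≤ ∑ k ∈ Finset.range n, ‖b k‖ ^ 2 := by
  obtain ⟨R, hR, hgR⟩ := exists_taylor_remainder hg n
  obtain ⟨S, hS, hhS⟩ := exists_taylor_remainder hh n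
  have hwle : ∀ z ∈ ball (0 : ℂ) 1, ‖w z‖ ≤ ‖z‖ := fun z hz =>
    norm_le_norm_of_mapsTo_ball hw (hwb.mono_right ball_subset_closedBall) hw0
      (mem_ball_zero_iff.mp hz)
  have hv : DifferentiableOn ℂ (dslope w 0) (ball 0 1) :=
    (differentiableOn_dslope (ball_mem_nhds 0 one_pos)).mpr hw
  have hwv : ∀ z, w z = z * dslope w 0 z := fun z => by
    simpa [hw0] using (sub_smul_dslope w 0 z).symm
  have hT : DifferentiableOn ℂ (fun z => R z - dslope w 0 z ^ n * S (w z)) (ball 0 1) :=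
    hR.sub ((hv.pow n).mul (hS.comp hw hwb))
  have key : ∀ r : ℝ, 0 ≤ r → r < 1 →
      ∑ k ∈ Finset.range n, ‖a k‖ ^ 2 * r ^ (2 * k) ≤
      ∑ k ∈ Finset.range n, ‖b k‖ ^ 2 * r ^ (2 * k) := fun r hr0 hr1 => by
    refine (sum_norm_sq_mul_pow_le_circleAverage hT hr0 hr1 n a).trans
      (le_trans (le_of_eq ?_) (circleAverage_norm_sq_polynomial_comp_le hw hw0 hwle hr0 hr1 n b))
    refine Real.circleAverage_congr_sphere fun z hz => ?_
    have hz1 : z ∈ ball (0 : ℂ) 1 := by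
      have : ‖z‖ = r := by simpa [abs_of_nonneg hr0] using hz
      simpa [this] using hr1
    have h1 := hgR z hz1
    rw [hgh z hz1, hhS _ (hwb hz1)] at h1
    have h2 : w z ^ n = z ^ n * dslope w 0 z ^ n := by rw [← mul_pow, ← hwv z]
    show ‖_‖ ^ 2 = ‖_‖ ^ 2
    congr 2
    linear_combination -h1 + h2 * S (w z)
  have hlim : ∀ c : ℕ → ℂ, Filter.Tendsto
      (fun r : ℝ => ∑ k ∈ Finset.range n, ‖c k‖ ^ 2 * r ^ (2 * k)) (nhdsWithin 1 (Set.Iio 1))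
      (nhds (∑ k ∈ Finset.range n, ‖c k‖ ^ 2)) := fun c => by
    have : Continuous fun r : ℝ => ∑ k ∈ Finset.range n, ‖c k‖ ^ 2 * r ^ (2 * k) := by fun_prop
    simpa using (this.tendsto 1).mono_left nhdsWithin_le_nhds
  refine le_of_tendsto_of_tendsto (hlim a) (hlim b) ?_
  filter_upwards [Ioo_mem_nhdsLT (zero_lt_one (α := ℝ))] with r hr
  exact key r hr.1.le hr.2

lemma hasSum_nat_mul_pow_deriv {c : ℕ → ℂ} {L : ℂ → ℂ}
    (h : ∀ z ∈ ball (0 : ℂ) 1, HasSum (fun k => c k * z ^ k) (L z)) :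
    DifferentiableOn ℂ L (ball 0 1) ∧
    ∀ z ∈ ball (0 : ℂ) 1, HasSum (fun k : ℕ => k * c k * z ^ k) (z * deriv L z) := by
  have hL : Set.EqOn L (fun z => ∑' k, c k * z ^ k) (ball 0 1) := fun z hz => (h z hz).tsum_eq.symm
  refine ⟨(differentiableOn_tsum_pow fun ρ h0 h1 => summable_norm_mul_pow h h0.le h1).congr hL,
    fun z hz => ?_⟩
  obtain ⟨ρ, hzρ, hρ1⟩ := exists_between (mem_ball_zero_iff.mp hz)
  have hρ0 : 0 < ρ := (norm_nonneg z).trans_lt hzρ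
  have hd := hasSum_deriv_of_summable_norm (F := fun k z => c k * z ^ k)
    (summable_norm_mul_pow h hρ0.le hρ1) (fun i => by fun_prop)
    (isOpen_ball (x := (0 : ℂ)) (ε := ρ)) (fun i w hw => by
      rw [norm_mul, norm_pow]
      have := (mem_ball_zero_iff.mp hw).le
      gcongr) (mem_ball_zero_iff.mpr hzρ)
  rw [← (hL.eventuallyEq_of_mem (isOpen_ball.mem_nhds hz)).deriv_eq] at hd
  refine (hd.mul_left z).congr_fun fun k => ?_
  rcases k with _ | k
  · simp
  · simp only [deriv_const_mul_field', deriv_pow_field, Nat.add_sub_cancel]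
    ring

lemma mul_deriv_div_eq_one_add {f L : ℂ → ℂ} {U : Set ℂ} (hU : IsOpen U)
    (hL : DifferentiableOn ℂ L U) (hfL : ∀ z ∈ U, z ≠ 0 → f z = z * exp (L z)) {z : ℂ}
    (hz : z ∈ U) (hz0 : z ≠ 0) : z * deriv f z / f z = 1 + z * deriv L z := by
  have hfe : f =ᶠ[nhds z] fun w => w * exp (L w) := by
    filter_upwards [hU.mem_nhds hz, isOpen_ne.mem_nhds hz0] with w hw hw0 using hfL w hw hw0
  have hLz := (hL.differentiableAt (hU.mem_nhds hz)).hasDerivAt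
  rw [hfe.deriv_eq, ((hasDerivAt_id' z).fun_mul hLz.cexp).deriv, hfL z hz hz0]
  have := exp_ne_zero (L z)
  field_simp

lemma exp_mul_I_sub_exp_neg_mul_I (δ : ℝ) :
    exp (δ * I) - exp (-(δ * I)) = 2 * I * (Real.sin δ : ℂ) := by
  rw [ofReal_sin, ← neg_mul, Complex.sin]
  linear_combination (exp (δ * I) - exp (-δ * I)) * I_sq

lemma norm_exp_sub_one_lt_s16 {δ : ℝ} (h0 : 0 < δ) (hπ : δ < Real.pi) {u : ℂ}
    (hu1 : δ - Real.pi < u.im) (hu2 : u.im < δ) :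
    ‖exp u - 1‖ < ‖exp (δ * I) - exp u * exp (-(δ * I))‖ := by
  have h1 : 0 < Real.sin (δ - u.im) := Real.sin_pos_of_pos_of_lt_pi (by linarith) (by linarith)
  have h2 : 0 < Real.sin δ := Real.sin_pos_of_pos_of_lt_pi h0 hπ
  have h3 : 0 < Real.exp u.re * (Real.sin δ * Real.sin (δ - u.im)) := by positivity
  rw [Real.sin_sub] at h3
  rw [← sq_lt_sq₀ (norm_nonneg _) (norm_nonneg _), Complex.sq_norm, Complex.sq_norm,
    normSq_apply, normSq_apply]
  have e1 : exp (-(δ * I)) = exp ((-δ : ℝ) * I) := by push_cast; ring_nf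
  rw [e1]
  simp only [sub_re, sub_im, mul_re, mul_im, exp_ofReal_mul_I_re, exp_ofReal_mul_I_im, one_re,
    one_im, Real.cos_neg, Real.sin_neg]
  rw [exp_re, exp_im]
  have s1 := Real.sin_sq_add_cos_sq δ
  set ρ := Real.exp u.re
  set s := Real.sin δ
  set c := Real.cos δ
  set S := Real.sin u.im
  set C := Real.cos u.im
  have key : (c - (ρ * C * c - ρ * S * -s)) * (c - (ρ * C * c - ρ * S * -s)) +
      (s - (ρ * C * -s + ρ * S * c)) * (s - (ρ * C * -s + ρ * S * c)) -
      ((ρ * C - 1) * (ρ * C - 1) + (ρ * S - 0) * (ρ * S - 0)) =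
      4 * (ρ * (s * (s * C - c * S))) := by
    linear_combination (1 + ρ ^ 2 * C ^ 2 + ρ ^ 2 * S ^ 2 - 2 * ρ * C) * s1
  linarith

lemma log_sub_log_eq {p q u : ℂ} (hp : 0 < p.re) (hq : 0 < q.re) (h : p = exp u * q)
    (hu : |u.im| < Real.pi) : log p - log q = u := by
  have hp0 : p ≠ 0 := fun h => by simp [h] at hp
  have hq0 : q ≠ 0 := fun h => by simp [h] at hq
  have hexp : exp (log p - log q) = exp u := by
    rw [exp_sub, exp_log hp0, exp_log hq0, h]
    field_simp
  obtain ⟨n, hn⟩ := exp_eq_exp_iff_exists_int.mp hexp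
  have hpa := abs_lt.mp (abs_arg_lt_pi_div_two_iff.mpr (.inl hp))
  have hqa := abs_lt.mp (abs_arg_lt_pi_div_two_iff.mpr (.inl hq))
  have hu' := abs_lt.mp hu
  have him := congrArg Complex.im hn
  simp only [sub_im, log_im, add_im, mul_im, mul_re, intCast_re, intCast_im, ofReal_re, ofReal_im,
    I_re, I_im, re_ofNat, im_ofNat] at him
  have h1 : (n : ℝ) < 1 := by nlinarith [Real.pi_pos]
  have h2 : (-1 : ℝ) < n := by nlinarith [Real.pi_pos]
  have h3 : n = 0 := by
    have h1' : n < 1 := by exact_mod_cast h1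
    have h2' : -1 < n := by exact_mod_cast h2
    omega
  simpa [h3] using hn

/-- The Taylor coefficients of the conformal map of the unit disc onto a vertical strip. -/
lemma hasSum_stripMap {δ : ℝ} (hs : Real.sin δ ≠ 0) {z : ℂ} (hz : z ∈ ball (0 : ℂ) 1) :
    HasSum (fun k : ℕ => (((-1) ^ (k + 1) * Real.sin (k * δ) / (k * Real.sin δ) : ℝ) : ℂ) * z ^ k)
      ((log (1 + z * exp (δ * I)) - log (1 + z * exp (-(δ * I)))) /
        (2 * I * (Real.sin δ : ℂ))) := by
  have e1 : exp (-(δ * I)) = exp ((-δ : ℝ) * I) := by push_cast; ring_nf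
  have hz' := mem_ball_zero_iff.mp hz
  have h1 := hasSum_taylorSeries_log (z := z * exp (δ * I)) (by simpa [norm_exp_ofReal_mul_I])
  have h2 := hasSum_taylorSeries_log (z := z * exp (-(δ * I)))
    (by rw [e1, norm_mul, norm_exp_ofReal_mul_I, mul_one]; exact hz')
  refine ((h1.sub h2).div_const (2 * I * (Real.sin δ : ℂ))).congr_fun fun k => ?_
  have e2 := exp_mul_I_sub_exp_neg_mul_I (k * δ)
  have e3 : exp (δ * I) ^ k = exp ((k * δ : ℝ) * I) := by
    rw [← exp_nat_mul]; push_cast; ring_nf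
  have e4 : exp (-(δ * I)) ^ k = exp (-((k * δ : ℝ) * I)) := by
    rw [← exp_nat_mul]; push_cast; ring_nf
  rw [mul_pow, mul_pow, e3, e4]
  have hs' : (Real.sin δ : ℂ) ≠ 0 := ofReal_ne_zero.mpr hs
  rcases eq_or_ne k 0 with rfl | hk
  · simp
  have hk' : (k : ℂ) ≠ 0 := Nat.cast_ne_zero.mpr hk
  have hI := I_ne_zero
  rw [← sub_div, ← mul_sub, ← mul_sub, e2]
  push_cast
  push_cast at hs'
  field_simp

/-- Every analytic function on the disc vanishing at `0` with values in the strip is subordinate to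
the conformal map onto the strip. -/
lemma exists_schwarz_of_re_mem_strip {δ : ℝ} (h0 : 0 < δ) (hπ : δ < Real.pi) {g : ℂ → ℂ}
    (hg : DifferentiableOn ℂ g (ball 0 1)) (hg0 : g 0 = 0)
    (hre : ∀ z ∈ ball (0 : ℂ) 1, (δ - Real.pi) / (2 * Real.sin δ) < (g z).re ∧
      (g z).re < δ / (2 * Real.sin δ)) :
    ∃ w : ℂ → ℂ, DifferentiableOn ℂ w (ball 0 1) ∧ w 0 = 0 ∧ Set.MapsTo w (ball 0 1) (ball 0 1) ∧
      ∀ z ∈ ball (0 : ℂ) 1, g z =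
        (log (1 + w z * exp (δ * I)) - log (1 + w z * exp (-(δ * I)))) /
          (2 * I * (Real.sin δ : ℂ)) := by
  have hs : 0 < Real.sin δ := Real.sin_pos_of_pos_of_lt_pi h0 hπ
  have hsC : (2 * I * (Real.sin δ : ℂ)) ≠ 0 := by
    have := ofReal_ne_zero.mpr hs.ne'
    simp [this, -ofReal_sin]
  set E := exp (δ * I) with hE
  set E' := exp (-(δ * I)) with hE'
  have hnE : ‖E‖ = 1 := norm_exp_ofReal_mul_I δ
  have hnE' : ‖E'‖ = 1 := by
    have e1 : E' = exp ((-δ : ℝ) * I) := by rw [hE']; push_cast; ring_nf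
    rw [e1, norm_exp_ofReal_mul_I]
  set u : ℂ → ℂ := fun z => 2 * I * (Real.sin δ : ℂ) * g z with hu
  have hud : DifferentiableOn ℂ u (ball 0 1) := hg.const_mul _
  have him : ∀ z, (u z).im = 2 * Real.sin δ * (g z).re := fun z => by
    simp [hu, -ofReal_sin]
  have hstrip : ∀ z ∈ ball (0 : ℂ) 1, δ - Real.pi < (u z).im ∧ (u z).im < δ := fun z hz => by
    obtain ⟨ha, hb⟩ := hre z hz
    rw [div_lt_iff₀ (by positivity)] at ha
    rw [lt_div_iff₀ (by positivity)] at hb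
    rw [him]
    constructor <;> linarith
  have hlt : ∀ z ∈ ball (0 : ℂ) 1, ‖exp (u z) - 1‖ < ‖E - exp (u z) * E'‖ := fun z hz =>
    norm_exp_sub_one_lt_s16 h0 hπ (hstrip z hz).1 (hstrip z hz).2
  have hD : ∀ z ∈ ball (0 : ℂ) 1, E - exp (u z) * E' ≠ 0 := fun z hz =>
    norm_pos_iff.mp ((norm_nonneg _).trans_lt (hlt z hz))
  set w : ℂ → ℂ := fun z => (exp (u z) - 1) / (E - exp (u z) * E') with hw
  have hwb : Set.MapsTo w (ball 0 1) (ball 0 1) := fun z hz => by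
    rw [mem_ball_zero_iff, hw]
    simp only [norm_div]
    rw [div_lt_one (norm_pos_iff.mpr (hD z hz))]
    exact hlt z hz
  refine ⟨w, ?_, by simp [hw, hu, hg0], hwb, fun z hz => ?_⟩
  · exact (hud.cexp.sub_const 1).div ((hud.cexp.mul_const E').const_sub E) hD
  · have hpos : ∀ ζ : ℂ, ‖ζ‖ = 1 → 0 < (1 + w z * ζ).re := fun ζ hζ => by
      have h1 : ‖w z * ζ‖ < 1 := by
        rw [norm_mul, hζ, mul_one]; exact mem_ball_zero_iff.mp (hwb hz)
      have := (abs_lt.mp ((abs_re_le_norm _).trans_lt h1)).1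
      rw [add_re, one_re]
      linarith
    rw [log_sub_log_eq (hpos E hnE) (hpos E' hnE') (u := u z), hu]
    · rw [mul_div_cancel_left₀ _ hsC]
    · have := hD z hz
      rw [hw]
      field_simp
      ring
    · have := hstrip z hz
      rw [abs_lt]
      constructor <;> linarith

lemma sum_mul_le_sum_mul_of_antitone {W x y : ℕ → ℝ} (hW : Antitone W) (hW0 : ∀ k, 0 ≤ W k)
    (h : ∀ n, ∑ k ∈ Finset.range n, x k ≤ ∑ k ∈ Finset.range n, y k) (n : ℕ) :
    ∑ k ∈ Finset.range n, W k * x k ≤ ∑ k ∈ Finset.range n, W k * y k := by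
  have key : ∀ n, W n * (∑ k ∈ Finset.range (n + 1), y k - ∑ k ∈ Finset.range (n + 1), x k) ≤
      ∑ k ∈ Finset.range (n + 1), W k * y k - ∑ k ∈ Finset.range (n + 1), W k * x k := fun n => by
    induction n with
    | zero => simp [mul_sub]
    | succ n ih =>
      have h1 := mul_le_mul_of_nonneg_right (hW n.le_succ) (sub_nonneg.mpr (h (n + 1)))
      simp only [Finset.sum_range_succ _ (n + 1)]
      rw [Nat.succ_eq_add_one] at h1
      linarith
  rcases n with _ | n
  · simp
  · exact sub_nonneg.mp ((mul_nonneg (hW0 n) (sub_nonneg.mpr (h (n + 1)))).trans (key n))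

lemma hasSum_Li4 {z : ℂ} (hz : ‖z‖ ≤ 1) :
    HasSum (fun n : ℕ => z ^ (n + 1) / ((n : ℂ) + 1) ^ 4) (Li4 z) := by
  refine Summable.hasSum (Summable.of_norm_bounded
    ((summable_nat_add_iff 1).mpr hasSum_zeta_four.summable) fun n => ?_)
  have : ‖((n : ℂ) + 1)‖ = (n : ℝ) + 1 := by exact_mod_cast norm_natCast (n + 1)
  rw [norm_div, norm_pow, norm_pow, this]
  push_cast
  gcongr
  exact pow_le_one₀ (norm_nonneg _) hz

lemma hasSum_sin_sq_div (δ : ℝ) :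
    HasSum (fun n : ℕ => (Real.sin ((n + 1) * δ)) ^ 2 / (4 * ((n : ℝ) + 1) ^ 4 * Real.sin δ ^ 2))
      ((1 / (16 * (Real.sin δ : ℂ) ^ 2)) *
        ((Real.pi : ℂ) ^ 4 / 45 -
          Li4 (Complex.exp (-2 * Complex.I * δ)) -
          Li4 (Complex.exp (2 * Complex.I * δ)))).re := by
  have hz : HasSum (fun n : ℕ => 1 / ((n : ℂ) + 1) ^ 4) ((Real.pi : ℂ) ^ 4 / 90) := by
    have h := (hasSum_nat_add_iff' 1).mpr hasSum_zeta_four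
    have := hasSum_ofReal.mpr h
    push_cast at this
    simpa using this
  have e1 : exp (-2 * I * δ) = exp ((-2 * δ : ℝ) * I) := by push_cast; ring_nf
  have e2 : exp (2 * I * δ) = exp ((2 * δ : ℝ) * I) := by push_cast; ring_nf
  rw [e1, e2]
  have h1 := hasSum_Li4 (norm_exp_ofReal_mul_I (-2 * δ)).le
  have h2 := hasSum_Li4 (norm_exp_ofReal_mul_I (2 * δ)).le
  have h := hasSum_re ((((hz.mul_left 2).sub h1).sub h2).mul_left (1 / (16 * (Real.sin δ : ℂ) ^ 2)))
  rw [show (Real.pi : ℂ) ^ 4 / 45 = 2 * ((Real.pi : ℂ) ^ 4 / 90) by ring]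
  refine h.congr_fun fun n => ?_
  have a1 : exp ((-2 * δ : ℝ) * I) ^ (n + 1) = exp (-(((n + 1) * δ : ℝ) * I)) ^ 2 := by
    rw [← exp_nat_mul, ← exp_nat_mul]; push_cast; ring_nf
  have a2 : exp ((2 * δ : ℝ) * I) ^ (n + 1) = exp (((n + 1) * δ : ℝ) * I) ^ 2 := by
    rw [← exp_nat_mul, ← exp_nat_mul]; push_cast; ring_nf
  have a3 := exp_mul_I_sub_exp_neg_mul_I ((n + 1) * δ)
  have a4 : exp (((n + 1) * δ : ℝ) * I) * exp (-(((n + 1) * δ : ℝ) * I)) = 1 := by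
    rw [← exp_add]; simp
  rw [a1, a2, ← ofReal_re (_ / _)]
  congr 1
  set A := exp (((n + 1) * δ : ℝ) * I)
  set B := exp (-(((n + 1) * δ : ℝ) * I))
  have a5 : (Real.sin ((n + 1) * δ) : ℂ) ^ 2 = (2 - A ^ 2 - B ^ 2) / 4 := by
    linear_combination (1 / 4) * (A - B + 2 * I * (Real.sin ((n + 1) * δ) : ℂ)) * a3 + a4 / 2
      + (Real.sin ((n + 1) * δ) : ℂ) ^ 2 * I_sq
  rw [ofReal_div, ofReal_pow, a5, ofReal_mul, ofReal_mul, ofReal_pow, ofReal_pow]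
  push_cast
  have hn : (n : ℂ) + 1 ≠ 0 := Nat.cast_add_one_ne_zero n
  rcases eq_or_ne (sin (δ : ℂ)) 0 with hs | hs
  · simp [hs]
  · field_simp
    ring

/-- For `f ∈ M(δ)`, the logarithmic coefficients satisfy
`Σ |γ_n|² ≤ (1/(16 sin²δ))(π⁴/45 - Li₄(e^{-2iδ}) - Li₄(e^{2iδ}))`. -/
theorem sum_sq_logCoeff_M_delta (δ : ℝ) (hδ1 : Real.pi / 2 ≤ δ) (hδ2 : δ < Real.pi)
    (f : ℂ → ℂ) (hf : DifferentiableOn ℂ f (ball 0 1))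
    (hf0 : f 0 = 0) (hf1 : deriv f 0 = 1)
    (hfz : ∀ z ∈ ball (0 : ℂ) 1, z ≠ 0 → f z ≠ 0)
    (hM : ∀ z ∈ ball (0 : ℂ) 1, z ≠ 0 →
      1 + (δ - Real.pi) / (2 * Real.sin δ) < (z * deriv f z / f z).re ∧
      (z * deriv f z / f z).re < 1 + δ / (2 * Real.sin δ))
    (γ : ℕ → ℂ)
    (hγ : ∀ z ∈ ball (0 : ℂ) 1, z ≠ 0 →
      HasSum (fun n : ℕ => 2 * γ (n + 1) * z ^ (n + 1)) (Complex.log (f z / z))) :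
    Summable (fun n : ℕ => ‖γ (n + 1)‖ ^ 2) ∧
    ∑' n : ℕ, ‖γ (n + 1)‖ ^ 2 ≤
      ((1 / (16 * (Real.sin δ : ℂ) ^ 2)) *
        ((Real.pi : ℂ) ^ 4 / 45 -
          Li4 (Complex.exp (-2 * Complex.I * δ)) -
          Li4 (Complex.exp (2 * Complex.I * δ)))).re := by
  have hδ0 : 0 < δ := by linarith [Real.pi_pos]
  have hs : 0 < Real.sin δ := Real.sin_pos_of_pos_of_lt_pi hδ0 hδ2
  set c : ℕ → ℂ := fun k => if k = 0 then 0 else 2 * γ k with hc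
  set L : ℂ → ℂ := fun z => ∑' k, c k * z ^ k with hL
  have hshift : ∀ z ∈ ball (0 : ℂ) 1, z ≠ 0 →
      HasSum (fun k => c k * z ^ k) (log (f z / z)) := fun z hz hz0 => by
    rw [← hasSum_nat_add_iff' 1]
    simpa [hc] using hγ z hz hz0
  have hLsum : ∀ z ∈ ball (0 : ℂ) 1, HasSum (fun k => c k * z ^ k) (L z) := fun z hz => by
    rcases eq_or_ne z 0 with rfl | hz0
    · exact (hasSum_single 0 fun k hk => by simp [hk]).summable.hasSum
    · exact (hshift z hz hz0).summable.hasSum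
  obtain ⟨hLd, hgsum⟩ := hasSum_nat_mul_pow_deriv hLsum
  have hfL : ∀ z ∈ ball (0 : ℂ) 1, z ≠ 0 → f z = z * exp (L z) := fun z hz hz0 => by
    rw [(hLsum z hz).unique (hshift z hz hz0), exp_log (div_ne_zero (hfz z hz hz0) hz0)]
    field_simp
  have hstrip : ∀ z ∈ ball (0 : ℂ) 1, (δ - Real.pi) / (2 * Real.sin δ) < (z * deriv L z).re ∧
      (z * deriv L z).re < δ / (2 * Real.sin δ) := fun z hz => by
    rcases eq_or_ne z 0 with rfl | hz0
    · rw [zero_mul, zero_re]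
      exact ⟨div_neg_of_neg_of_pos (by linarith) (by positivity), by positivity⟩
    · have h := hM z hz hz0
      rw [mul_deriv_div_eq_one_add isOpen_ball hLd hfL hz hz0, add_re, one_re] at h
      constructor <;> linarith
  obtain ⟨w, hw, hw0, hwb, hgw⟩ := exists_schwarz_of_re_mem_strip hδ0 hδ2
    (differentiableOn_id.mul (hLd.deriv isOpen_ball)) (by simp) hstrip
  have hpartial := sum_norm_sq_le_of_subordinate hgsum (fun z hz => hasSum_stripMap hs.ne' hz)
    hw hw0 hwb hgw
  have hW : Antitone fun k : ℕ => 1 / (4 * ((k : ℝ) + 1) ^ 2) := fun i j hij => by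
    have : (i : ℝ) ≤ j := Nat.cast_le.mpr hij
    simp only
    gcongr
  have hshifted : ∀ n, ∑ k ∈ Finset.range n, ‖((k + 1 : ℕ) : ℂ) * c (k + 1)‖ ^ 2 ≤
      ∑ k ∈ Finset.range n, ‖(((-1) ^ (k + 1 + 1) * Real.sin ((k + 1 : ℕ) * δ) /
        ((k + 1 : ℕ) * Real.sin δ) : ℝ) : ℂ)‖ ^ 2 := fun n => by
    have h := hpartial (n + 1)
    rw [Finset.sum_range_succ', Finset.sum_range_succ'] at h
    simpa only [Nat.cast_zero, zero_mul, norm_zero, Real.sin_zero, mul_zero, zero_div, ofReal_zero,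
      zero_pow two_ne_zero, add_zero] using h
  have habel := sum_mul_le_sum_mul_of_antitone hW (fun k => by positivity) hshifted
  have hT := hasSum_sin_sq_div δ
  have hbound : ∀ n, ∑ k ∈ Finset.range n, ‖γ (k + 1)‖ ^ 2 ≤ _ := fun n =>
    calc
      ∑ k ∈ Finset.range n, ‖γ (k + 1)‖ ^ 2 = _ := Finset.sum_congr rfl fun k _ => ?_
      _ ≤ _ := habel n
      _ = ∑ k ∈ Finset.range n,
          Real.sin ((k + 1) * δ) ^ 2 / (4 * ((k : ℝ) + 1) ^ 4 * Real.sin δ ^ 2) :=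
        Finset.sum_congr rfl fun k _ => ?_
      _ ≤ _ := sum_le_hasSum _ (fun k _ => by positivity) hT
  · exact ⟨summable_of_sum_range_le (fun k => by positivity) hbound,
      Real.tsum_le_of_sum_range_le (fun k => by positivity) hbound⟩
  · have h1 : ‖((k + 1 : ℕ) : ℂ)‖ = (k : ℝ) + 1 := by rw [Complex.norm_natCast]; push_cast; rfl
    rw [norm_mul, h1]
    simp only [hc, Nat.add_one_ne_zero, if_false, norm_mul, norm_ofNat]
    field_simp
    ring
  · rw [norm_real, Real.norm_eq_abs, sq_abs, div_pow, mul_pow, ← pow_mul, mul_comm _ 2, pow_mul]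
    push_cast
    field_simp
    ring
end
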